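/- If a group G contains an infinite cyclic subgroup of finite index, then G admits a finitary selector: a macro-uniform map f from the nonempty finite subsets of G to G with f(A) ∈ A for every nonempty finite A ⊆ G. -/

import Mathlib

open scoped Pointwise

/-- A finitary selector of a group `G`: a map from the nonempty finite subsets of `G` to `G`
choosing a point of each nonempty finite set, which is macro-uniform with respect to the
finitary coarse structure of `G`. -/
def IsFinitarySelector (G : Type*) [Group G] (f : Finset G → G) : Prop :=
  (∀ A : Finset G, A.Nonempty → f A ∈ A) ∧
  ∀ F : Finset G, (1 : G) ∈ F → ∃ F' : Finset G, (1 : G) ∈ F' ∧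
    ∀ A B : Finset G, A.Nonempty → B.Nonempty →
      (A : Set G) ⊆ (F : Set G) * (B : Set G) → (B : Set G) ⊆ (F : Set G) * (A : Set G) →
      ∃ g ∈ F', f A = g * f B

/-- A group containing an infinite cyclic subgroup of finite index admits a finitary
selector. -/
theorem finitarySelector_of_infinite_cyclic_finiteIndex {G : Type*} [Group G]
    (a : G) (ha : ¬ IsOfFinOrder a) (hfi : (Subgroup.zpowers a).FiniteIndex) :
    ∃ f : Finset G → G, IsFinitarySelector G f := by
  classical
  have hfin : Finite (G ⧸ Subgroup.zpowers a) := inferInstance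
  have hinj : Function.Injective (fun n : ℤ => a ^ n) := injective_zpow_iff_not_isOfFinOrder.mpr ha
  let t : G → G := fun x => (QuotientGroup.mk x : G ⧸ Subgroup.zpowers a).out
  have ht : (Set.range t).Finite := by
    refine (Set.finite_range (fun q : G ⧸ Subgroup.zpowers a => q.out)).subset ?_
    rintro _ ⟨x, rfl⟩
    exact ⟨_, rfl⟩
  have hk : ∀ x, ∃ k : ℤ, x = t x * a ^ k := by
    intro x
    have h : (QuotientGroup.mk (t x) : G ⧸ Subgroup.zpowers a) = QuotientGroup.mk x :=
      Quotient.out_eq' _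
    obtain ⟨k, hk⟩ := Subgroup.mem_zpowers_iff.mp (QuotientGroup.eq.mp h)
    exact ⟨k, by rw [hk]; group⟩
  choose p hp using hk
  have hex : ∀ A : Finset G, ∃ x, A.Nonempty → x ∈ A ∧ ∀ y ∈ A, p x ≤ p y := by
    intro A
    by_cases hA : A.Nonempty
    · obtain ⟨x, hx, h⟩ := A.exists_min_image p hA
      exact ⟨x, fun _ => ⟨hx, h⟩⟩
    · exact ⟨1, fun h => absurd h hA⟩
  choose f hf using hex
  refine ⟨f, fun A hA => (hf A hA).1, fun F _ => ?_⟩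
  have hS : ((Set.range t)⁻¹ * (F : Set G) * Set.range t).Finite :=
    (ht.inv.mul F.finite_toSet).mul ht
  have hJ : ((fun n : ℤ => a ^ n) ⁻¹' ((Set.range t)⁻¹ * (F : Set G) * Set.range t)).Finite :=
    hS.preimage hinj.injOn
  obtain ⟨C, hC⟩ := (hJ.image (fun n : ℤ => |n|)).bddAbove
  have hb : ∀ g ∈ F, ∀ y, |p (g * y) - p y| ≤ C := by
    intro g hg y
    refine hC ⟨_, ?_, rfl⟩
    have h : a ^ (p (g * y) - p y) = (t (g * y))⁻¹ * g * t y := by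
      have h1 := hp (g * y)
      have h2 := hp y
      have h3 : a ^ p (g * y) = (t (g * y))⁻¹ * (g * y) := eq_inv_mul_of_mul_eq h1.symm
      have h4 : (a ^ p y)⁻¹ = y⁻¹ * t y := by
        rw [inv_eq_iff_eq_inv, mul_inv_rev, inv_inv]; exact eq_inv_mul_of_mul_eq h2.symm
      rw [zpow_sub, h3, h4]; group
    rw [Set.mem_preimage]
    rw [h]
    exact Set.mul_mem_mul (Set.mul_mem_mul (Set.inv_mem_inv.mpr ⟨_, rfl⟩) hg) ⟨_, rfl⟩
  have key : ∀ A B : Finset G, A.Nonempty → B.Nonempty →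
      (B : Set G) ⊆ (F : Set G) * (A : Set G) → p (f A) ≤ p (f B) + C := by
    intro A B hA hB h
    obtain ⟨g, hg, y, hy, hgy⟩ := Set.mem_mul.mp (h (hf B hB).1)
    have h1 := (hf A hA).2 y hy
    have h2 := abs_le.mp (hb g hg y)
    rw [hgy] at h2
    linarith [h2.1]
  have hF : (Set.range t * (fun n : ℤ => a ^ n) '' Set.Icc (-C) C * (Set.range t)⁻¹).Finite :=
    (ht.mul ((Set.finite_Icc _ _).image _)).mul ht.inv
  refine ⟨insert 1 hF.toFinset, Finset.mem_insert_self _ _, fun A B hA hB h1 h2 => ?_⟩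
  refine ⟨f A * (f B)⁻¹, ?_, by group⟩
  refine Finset.mem_insert_of_mem (hF.mem_toFinset.mpr ?_)
  have h : f A * (f B)⁻¹ = t (f A) * a ^ (p (f A) - p (f B)) * (t (f B))⁻¹ := by
    conv_lhs => rw [hp (f A), hp (f B)]
    rw [zpow_sub]; group
  rw [h]
  refine Set.mul_mem_mul (Set.mul_mem_mul ⟨_, rfl⟩ ⟨_, ⟨?_, ?_⟩, rfl⟩) (Set.inv_mem_inv.mpr ⟨_, rfl⟩)
  · linarith [key B A hB hA h1]
  · linarith [key A B hA hB h2]
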